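/- arXiv:1903.01393 — 3 statements merged into one kernel-verified Lean document; each statement's English description precedes it below -/
import Mathlib

section
/- For every pair of integers a, b ≥ 2, there is a unique integer n ≥ 3 for which there exists a smooth arithmetical structure on D_n with d_x = b and d_y = a; moreover, for that n, the smooth arithmetical structure on D_n with d_x = b and d_y = a is unique. (Note that for an arithmetical structure d_x = r_0/r_x and d_y = r_0/r_y, so this is equivalent to the rescaled vector r̄ = (r_0/(r_x·r_y))·r having r̄_x = a and r̄_y = b.) -/
/-- `IsArith n dx dy d rx ry r` says that `(d, r)` is an arithmetical structure on the
bident `D_n` (with `ℓ = n - 3`): `dx, dy, rx, ry` are the values at the prong vertices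
`v_x, v_y`, and `d i, r i` (for `0 ≤ i ≤ n - 3`) are the values at the path vertices
`v_0, v_1, …, v_ℓ`. -/
def IsArith (n dx dy : ℕ) (d : ℕ → ℕ) (rx ry : ℕ) (r : ℕ → ℕ) : Prop :=
  3 ≤ n ∧
  0 < dx ∧ 0 < dy ∧ (∀ i, i ≤ n - 3 → 0 < d i) ∧
  0 < rx ∧ 0 < ry ∧ (∀ i, i ≤ n - 3 → 0 < r i) ∧
  dx * rx = r 0 ∧ dy * ry = r 0 ∧
  (1 ≤ n - 3 → d 0 * r 0 = rx + ry + r 1) ∧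
  (n - 3 = 0 → d 0 * r 0 = rx + ry) ∧
  (∀ i, 1 ≤ i → i + 1 ≤ n - 3 → d i * r i = r (i - 1) + r (i + 1)) ∧
  (1 ≤ n - 3 → d (n - 3) * r (n - 3) = r (n - 3 - 1)) ∧
  (∀ c : ℕ, c ∣ rx → c ∣ ry → (∀ i, i ≤ n - 3 → c ∣ r i) → c = 1)

/-- An arithmetical structure on `D_n` is *smooth* if `d_x, d_y ≥ 2` and `d_i ≥ 2` for all
`1 ≤ i ≤ ℓ = n - 3`. -/
def IsSmooth (n dx dy : ℕ) (d : ℕ → ℕ) : Prop :=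
  2 ≤ dx ∧ 2 ≤ dy ∧ ∀ i, 1 ≤ i → i ≤ n - 3 → 2 ≤ d i

/-- The least natural number `t` such that `q ∣ p + t` (and `0` when `q = 0`). -/
def negMod (p q : ℕ) : ℕ := if q = 0 then 0 else (q - p % q) % q

/-- The sequence of negative remainders of the Euclidean algorithm started at `p, q`. -/
def negRem (p q : ℕ) : ℕ → ℕ
  | 0 => p
  | 1 => q
  | i + 2 => negMod (negRem p q i) (negRem p q (i + 1))

theorem negMod_zero_right (p : ℕ) : negMod p 0 = 0 := by simp [negMod]

theorem negMod_lt (p : ℕ) {q : ℕ} (hq : 0 < q) : negMod p q < q := by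
  rw [negMod, if_neg hq.ne']
  exact Nat.mod_lt _ hq

theorem dvd_add_negMod (p : ℕ) {q : ℕ} (hq : 0 < q) : q ∣ p + negMod p q := by
  rw [negMod, if_neg hq.ne', Nat.dvd_iff_mod_eq_zero, Nat.add_mod, Nat.mod_mod, ← Nat.mod_add_mod,
    Nat.mod_mod, Nat.add_mod_mod, Nat.add_sub_cancel' (Nat.mod_lt p hq).le, Nat.mod_self]

theorem eq_negMod {p q d t : ℕ} (h : d * q = p + t) (ht : t < q) : t = negMod p q := by
  have hq : 0 < q := by omega
  have h1 : p + t ≡ p + negMod p q [MOD q] :=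
    ((Nat.modEq_zero_iff_dvd.2 ⟨d, by rw [← h, mul_comm]⟩)).trans
      (Nat.modEq_zero_iff_dvd.2 (dvd_add_negMod p hq)).symm
  exact (Nat.ModEq.add_left_cancel' p h1).eq_of_lt_of_lt ht (negMod_lt p hq)

theorem negMod_mul_right (p q c : ℕ) : negMod (p * c) (q * c) = negMod p q * c := by
  rcases Nat.eq_zero_or_pos c with rfl | hc
  · simp [negMod]
  · by_cases hq : q = 0
    · simp [negMod, hq]
    · rw [negMod, negMod, if_neg hq, if_neg (Nat.mul_ne_zero hq hc.ne'), Nat.mul_mod_mul_right,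
        ← Nat.sub_mul, Nat.mul_mod_mul_right]

theorem negRem_mul_right (p q c i : ℕ) : negRem (p * c) (q * c) i = negRem p q i * c := by
  induction i using Nat.twoStepInduction with
  | zero => rfl
  | one => rfl
  | more i h0 h1 => rw [negRem, h0, h1, negMod_mul_right, negRem]

theorem exists_negRem_eq_zero (p q : ℕ) : ∃ i, negRem p q (i + 1) = 0 := by
  by_contra! h
  have key : ∀ i, negRem p q (i + 1) + i ≤ q := by
    intro i
    induction i with
    | zero => simp [negRem]
    | succ i ih =>
      have h2 := negMod_lt (negRem p q i) (Nat.pos_of_ne_zero (h i))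
      have h3 : negRem p q (i + 1 + 1) = negMod (negRem p q i) (negRem p q (i + 1)) := rfl
      omega
  have h1 := key (q + 1)
  omega

theorem IsArith.succ_lt {n dx dy rx ry : ℕ} {d r : ℕ → ℕ}
    (h : IsArith n dx dy d rx ry r) (hs : IsSmooth n dx dy d) {i : ℕ} (hi : i + 1 ≤ n - 3) :
    r (i + 1) < r i := by
  obtain ⟨-, -, -, -, -, -, hr, -, -, -, -, hmid, hend, -⟩ := h
  obtain ⟨-, -, hd⟩ := hs
  induction hk : n - 3 - (i + 1) generalizing i with
  | zero =>
    have hl : n - 3 = i + 1 := by omega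
    have h1 := hend (by omega)
    have h2 := hd (i + 1) (by omega) hi
    have h3 := hr (i + 1) hi
    rw [hl, Nat.add_sub_cancel] at h1
    nlinarith
  | succ k ih =>
    have h1 := hmid (i + 1) (by omega) (by omega)
    have h2 := hd (i + 1) (by omega) hi
    have h3 : r (i + 1 + 1) < r (i + 1) := ih (by omega) (by omega)
    rw [Nat.add_sub_cancel] at h1
    nlinarith

theorem IsArith.eq_negRem {n dx dy rx ry : ℕ} {d r : ℕ → ℕ}
    (h : IsArith n dx dy d rx ry r) (hs : IsSmooth n dx dy d) (i : ℕ) :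
    negRem (rx + ry) (r 0) (i + 1) = if i ≤ n - 3 then r i else 0 := by
  have hlt : ∀ i, i + 1 ≤ n - 3 → r (i + 1) < r i := fun i hi => h.succ_lt hs hi
  obtain ⟨-, -, -, -, -, -, hr, -, -, h0, h0', hmid, hend, -⟩ := h
  induction i using Nat.twoStepInduction with
  | zero => simp [negRem]
  | one =>
    change negMod (rx + ry) (r 0) = _
    split_ifs with hi
    · exact (eq_negMod (h0 hi) (hlt 0 hi)).symm
    · exact (eq_negMod (t := 0) (h0' (by omega)) (hr 0 (Nat.zero_le _))).symm
  | more i hi0 hi1 =>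
    rw [negRem, hi0, hi1]
    by_cases h1 : i + 1 ≤ n - 3
    · rw [if_pos h1, if_pos (by omega)]
      by_cases h2 : i + 2 ≤ n - 3
      · rw [if_pos h2]
        exact (eq_negMod (hmid (i + 1) (by omega) h2) (hlt (i + 1) h2)).symm
      · rw [if_neg h2]
        have hl : n - 3 = i + 1 := by omega
        have h3 := hend (by omega)
        rw [hl, Nat.add_sub_cancel] at h3
        exact (eq_negMod (t := 0) h3 (hr (i + 1) h1)).symm
    · rw [if_neg h1, negMod_zero_right, if_neg (by omega)]

theorem IsArith.mul_prong_eq {n n' dx dy rx ry rx' ry' : ℕ} {d r d' r' : ℕ → ℕ}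
    (h : IsArith n dx dy d rx ry r) (h' : IsArith n' dx dy d' rx' ry' r') :
    rx * r' 0 = rx' * r 0 ∧ ry * r' 0 = ry' * r 0 := by
  obtain ⟨-, -, -, -, -, -, -, hx, hy, -⟩ := h
  obtain ⟨-, -, -, -, -, -, -, hx', hy', -⟩ := h'
  constructor
  · rw [← hx, ← hx']; ring
  · rw [← hy, ← hy']; ring

theorem IsArith.mul_path_eq {n n' dx dy rx ry rx' ry' : ℕ} {d r d' r' : ℕ → ℕ}
    (h : IsArith n dx dy d rx ry r) (hs : IsSmooth n dx dy d)
    (h' : IsArith n' dx dy d' rx' ry' r') (hs' : IsSmooth n' dx dy d') (i : ℕ) :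
    (if i ≤ n - 3 then r i else 0) * r' 0 = (if i ≤ n' - 3 then r' i else 0) * r 0 := by
  obtain ⟨hx, hy⟩ := h.mul_prong_eq h'
  rw [← h.eq_negRem hs, ← h'.eq_negRem hs', ← negRem_mul_right, ← negRem_mul_right, add_mul,
    add_mul, hx, hy, mul_comm (r 0)]

theorem IsArith.le_of_smooth {n n' dx dy rx ry rx' ry' : ℕ} {d r d' r' : ℕ → ℕ}
    (h : IsArith n dx dy d rx ry r) (hs : IsSmooth n dx dy d)
    (h' : IsArith n' dx dy d' rx' ry' r') (hs' : IsSmooth n' dx dy d') : n ≤ n' := by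
  have hmul := h.mul_path_eq hs h' hs' (n - 3)
  obtain ⟨hn, -, -, -, -, -, hr, -⟩ := h
  obtain ⟨hn', -, -, -, -, -, hr', -⟩ := h'
  by_contra! hlt
  rw [if_pos le_rfl, if_neg (by omega), zero_mul] at hmul
  exact (Nat.mul_pos (hr _ le_rfl) (hr' 0 (Nat.zero_le _))).ne' hmul

theorem IsArith.zero_dvd_zero {n dx dy rx ry rx' ry' : ℕ} {d r d' r' : ℕ → ℕ}
    (h : IsArith n dx dy d rx ry r) (hs : IsSmooth n dx dy d)
    (h' : IsArith n dx dy d' rx' ry' r') (hs' : IsSmooth n dx dy d') : r 0 ∣ r' 0 := by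
  have hmul := h.mul_path_eq hs h' hs'
  obtain ⟨hx, hy⟩ := h.mul_prong_eq h'
  obtain ⟨-, -, -, -, -, -, hr, -, -, -, -, -, -, hgcd⟩ := h
  have hg : 0 < (r 0).gcd (r' 0) := Nat.gcd_pos_of_pos_left _ (hr 0 (Nat.zero_le _))
  have key : ∀ x y : ℕ, x * r' 0 = y * r 0 → r 0 / (r 0).gcd (r' 0) ∣ x := by
    intro x y hxy
    refine (Nat.coprime_div_gcd_div_gcd hg).dvd_of_dvd_mul_right ?_
    refine Nat.dvd_of_mul_dvd_mul_right hg ?_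
    rw [mul_assoc, Nat.div_mul_cancel (Nat.gcd_dvd_left _ _),
      Nat.div_mul_cancel (Nat.gcd_dvd_right _ _), hxy]
    exact Dvd.intro_left y rfl
  have h1 := hgcd _ (key _ _ hx) (key _ _ hy) fun i hi => by
    have h2 := hmul i
    rw [if_pos hi, if_pos hi] at h2
    exact key _ _ h2
  have h3 := Nat.div_mul_cancel (Nat.gcd_dvd_left (r 0) (r' 0))
  rw [h1, one_mul] at h3
  exact Nat.gcd_eq_left_iff_dvd.1 h3

theorem IsArith.eq_of_smooth {n dx dy rx ry rx' ry' : ℕ} {d r d' r' : ℕ → ℕ}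
    (h : IsArith n dx dy d rx ry r) (hs : IsSmooth n dx dy d)
    (h' : IsArith n dx dy d' rx' ry' r') (hs' : IsSmooth n dx dy d') :
    rx = rx' ∧ ry = ry' ∧ ∀ i, i ≤ n - 3 → d i = d' i ∧ r i = r' i := by
  have h0 : r 0 = r' 0 :=
    Nat.dvd_antisymm (h.zero_dvd_zero hs h' hs') (h'.zero_dvd_zero hs' h hs)
  have hmul := h.mul_path_eq hs h' hs'
  obtain ⟨hx, hy⟩ := h.mul_prong_eq h'
  obtain ⟨-, -, -, -, -, -, hr, -, -, ha, hb, hc, he, -⟩ := h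
  obtain ⟨-, -, -, -, -, -, hr', -, -, ha', hb', hc', he', -⟩ := h'
  have hpos : 0 < r' 0 := hr' 0 (Nat.zero_le _)
  rw [h0] at hx hy
  have hrx := Nat.eq_of_mul_eq_mul_right hpos hx
  have hry := Nat.eq_of_mul_eq_mul_right hpos hy
  have hri : ∀ i, i ≤ n - 3 → r i = r' i := fun i hi => by
    have h2 := hmul i
    rw [if_pos hi, if_pos hi, h0] at h2
    exact Nat.eq_of_mul_eq_mul_right hpos h2
  refine ⟨hrx, hry, fun i hi => ⟨Nat.eq_of_mul_eq_mul_right (hr i hi) ?_, hri i hi⟩⟩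
  conv_rhs => rw [hri i hi]
  rcases Nat.eq_zero_or_pos i with rfl | hi0
  · rcases Nat.eq_zero_or_pos (n - 3) with hl | hl
    · rw [hb hl, hb' hl, hrx, hry]
    · rw [ha hl, ha' hl, hrx, hry, hri 1 hl]
  · rcases hi.eq_or_lt with rfl | hlt
    · rw [he hi0, he' hi0, hri _ (Nat.sub_le _ _)]
    · rw [hc i hi0 hlt, hc' i hi0 hlt, hri _ (by omega), hri _ hlt]

theorem exists_smooth_isArith {a b : ℕ} (ha : 2 ≤ a) (hb : 2 ≤ b) :
    ∃ n d rx ry r, IsArith n b a d rx ry r ∧ IsSmooth n b a d := by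
  obtain ⟨g, x, y, hg, hxy, rfl, rfl⟩ :=
    Nat.exists_coprime' (Nat.gcd_pos_of_pos_left b (by omega : 0 < a))
  have hx : 0 < x := Nat.pos_of_ne_zero (by rintro rfl; simp at ha)
  have hy : 0 < y := Nat.pos_of_ne_zero (by rintro rfl; simp at hb)
  set S := negRem (x + y) (x * y * g) with hS
  have hex : ∃ i, S (i + 1) = 0 := exists_negRem_eq_zero _ _
  have hS1 : S 1 = x * y * g := rfl
  have hpos1 : 0 < S 1 := by rw [hS1]; positivity
  obtain ⟨l, hl⟩ : ∃ l, Nat.find hex = l + 1 := by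
    refine Nat.exists_eq_succ_of_ne_zero fun h => ?_
    have := Nat.find_spec hex
    rw [h] at this
    exact hpos1.ne' this
  have hzero : S (l + 2) = 0 := by
    have := Nat.find_spec hex
    rwa [hl] at this
  have hpos : ∀ i, i ≤ l → 0 < S (i + 1) := fun i hi =>
    Nat.pos_of_ne_zero (Nat.find_min hex (by omega))
  have hdvd : ∀ i, i ≤ l → (S i + S (i + 2)) / S (i + 1) * S (i + 1) = S i + S (i + 2) :=
    fun i hi => Nat.div_mul_cancel (dvd_add_negMod _ (hpos i hi))
  have hlt : ∀ i, i ≤ l → S (i + 2) < S (i + 1) := fun i hi => negMod_lt _ (hpos i hi)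
  have hd2 : ∀ i, 1 ≤ i → i ≤ l → 2 ≤ (S i + S (i + 2)) / S (i + 1) := by
    intro i h1 hi
    obtain ⟨j, rfl⟩ := Nat.exists_eq_add_of_le' h1
    have h2 := hlt j (by omega)
    have h3 := hdvd (j + 1) hi
    have h4 : S (j + 1 + 1) < S (j + 1) := h2
    by_contra! hc
    have h5 : (S (j + 1) + S (j + 1 + 2)) / S (j + 1 + 1) ≤ 1 := by omega
    nlinarith
  have hd0 : 0 < (S 0 + S (0 + 2)) / S (0 + 1) := by
    have h3 := hdvd 0 (Nat.zero_le _)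
    have h4 : S 0 = x + y := rfl
    refine Nat.pos_of_ne_zero fun h => ?_
    rw [h] at h3
    omega
  refine ⟨l + 3, fun i => (S i + S (i + 2)) / S (i + 1), x, y, fun i => S (i + 1), ?_, hb, ha, hd2⟩
  refine ⟨by omega, by omega, by omega, ?_, hx, hy, hpos, ?_, ?_, ?_, ?_, ?_, ?_, ?_⟩
  · intro i hi
    rcases Nat.eq_zero_or_pos i with rfl | h0
    · exact hd0
    · exact lt_of_lt_of_le two_pos (hd2 i h0 hi)
  · change _ = S 1
    rw [hS1]; ring
  · change _ = S 1
    rw [hS1]; ring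
  · intro _
    exact hdvd 0 (Nat.zero_le _)
  · intro h
    obtain rfl : l = 0 := h
    have h3 := hdvd 0 le_rfl
    rw [hzero] at h3
    change _ = S 0
    simpa [hzero] using h3
  · intro i h1 hi
    obtain ⟨j, rfl⟩ := Nat.exists_eq_add_of_le' h1
    exact hdvd (j + 1) (by omega)
  · intro h1
    obtain ⟨j, rfl⟩ := Nat.exists_eq_add_of_le' (show 1 ≤ l from h1)
    have h3 := hdvd (j + 1) le_rfl
    rw [hzero] at h3
    simpa [hzero] using h3
  · intro c hcx hcy _
    exact Nat.eq_one_of_dvd_coprimes hxy hcx hcy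


/-- **Proposition 3.1.**  For every pair of integers `a, b ≥ 2`, there is a unique `n ≥ 3`
such that there is a smooth arithmetical structure on `D_n` with `d_x = b` and `d_y = a`
(equivalently, with `r̄_x = a` and `r̄_y = b`); moreover this smooth arithmetical structure
is unique. -/
theorem smooth_unique_of_dx_dy (a b : ℕ) (ha : 2 ≤ a) (hb : 2 ≤ b) :
    (∃! n : ℕ, 3 ≤ n ∧ ∃ d rx ry r, IsArith n b a d rx ry r ∧ IsSmooth n b a d) ∧
    (∀ n d rx ry r d' rx' ry' r',
      IsArith n b a d rx ry r → IsSmooth n b a d →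
      IsArith n b a d' rx' ry' r' → IsSmooth n b a d' →
      rx = rx' ∧ ry = ry' ∧ ∀ i, i ≤ n - 3 → d i = d' i ∧ r i = r' i) := by
  refine ⟨?_, fun _ _ _ _ _ _ _ _ _ h hs h' hs' => h.eq_of_smooth hs h' hs'⟩
  obtain ⟨n, d, rx, ry, r, h, hs⟩ := exists_smooth_isArith ha hb
  refine ⟨n, ⟨h.1, d, rx, ry, r, h, hs⟩, ?_⟩
  rintro m ⟨-, d', rx', ry', r', h', hs'⟩
  exact le_antisymm (h'.le_of_smooth hs' h hs) (h.le_of_smooth hs h' hs')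
end

section
/- Let a, b ≥ 2 be integers and write a + b = t·b² + ε, where t and ε are integers with t ≥ 0 and 0 ≤ ε ≤ b² − 1. Then there is a (unique) smooth arithmetical structure on D_n with d_x = b and d_y = a when n = F(b², ε) + t + ⌊ab/(a+b)⌋, and for every other value of n there is no smooth arithmetical structure on D_n with d_x = b and d_y = a. -/
/-- `F x₁ x₂` is the number of positive terms of the sequence `x₁, x₂, x₃, …` in which
`x_{i+1}` is the least nonnegative residue of `-x_{i-1}` modulo `x_i` (the sequence is
continued as long as `x_i > 0`).  In particular `F x 0 = 1`. -/
def F (x y : ℕ) : ℕ :=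
  if h : y = 0 then 1
  else 1 + F y ((y - x % y) % y)
termination_by y
decreasing_by exact Nat.mod_lt _ (Nat.pos_of_ne_zero h)

section EuclideanLength

theorem F_zero_right (x : ℕ) : F x 0 = 1 := by
  rw [F]; simp

theorem F_of_pos {x y : ℕ} (hy : 0 < y) : F x y = 1 + F y ((y - x % y) % y) := by
  rw [F, dif_neg hy.ne']

theorem F_pos (x y : ℕ) : 0 < F x y := by
  rw [F]; split <;> omega

theorem neg_mod_eq_of_add_eq_mul {x y z d : ℕ} (hz : z < y) (h : x + z = d * y) :
    (y - x % y) % y = z := by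
  have hy : 0 < y := by omega
  have hxy := Nat.mod_lt x hy
  have hdvd : y ∣ x % y + z := by
    rw [Nat.dvd_iff_mod_eq_zero, Nat.mod_add_mod, h, Nat.mul_mod_left]
  obtain ⟨c, hc⟩ := hdvd
  have hc2 : c < 2 := by
    by_contra! h2
    nlinarith
  interval_cases c
  · have : z = 0 := by omega
    have : x % y = 0 := by omega
    simp_all
  · rw [show y - x % y = z by omega, Nat.mod_eq_of_lt hz]

theorem exists_add_neg_mod_eq_mul (x : ℕ) {y : ℕ} (hy : 0 < y) :
    ∃ d, x + (y - x % y) % y = d * y := by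
  have hxy := (Nat.mod_lt x hy).le
  have h : y ∣ x + (y - x % y) % y := by
    rw [Nat.dvd_iff_mod_eq_zero, Nat.add_mod_mod, ← Nat.mod_add_mod,
      Nat.add_sub_cancel' hxy, Nat.mod_self]
  obtain ⟨c, hc⟩ := h
  exact ⟨c, by rw [hc, mul_comm]⟩

theorem F_mul_left {g : ℕ} (hg : 0 < g) (x y : ℕ) : F (g * x) (g * y) = F x y := by
  induction y using Nat.strong_induction_on generalizing x with
  | _ y ih =>
    rcases Nat.eq_zero_or_pos y with rfl | hy
    · simp [F_zero_right]
    · rw [F_of_pos hy, F_of_pos (Nat.mul_pos hg hy), Nat.mul_mod_mul_left, ← Nat.mul_sub,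
        Nat.mul_mod_mul_left, ih _ (Nat.mod_lt _ hy)]

theorem F_add_self_left (x y : ℕ) : F (x + y) y = F x y := by
  rcases Nat.eq_zero_or_pos y with rfl | hy
  · simp
  · rw [F_of_pos hy, F_of_pos hy, Nat.add_mod_right]

theorem F_add_self_right {x : ℕ} (hx : 0 < x) (y : ℕ) : F x (y + x) = F x y + 1 := by
  have hmod : (y + x - x % (y + x)) % (y + x) = y :=
    neg_mod_eq_of_add_eq_mul (d := 1) (by omega) (by ring)
  rw [F_of_pos (by omega), hmod, add_comm y x, F_add_self_left, add_comm]

theorem F_add_mul_self_right {x : ℕ} (hx : 0 < x) (y t : ℕ) :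
    F x (t * x + y) = F x y + t := by
  induction t with
  | zero => simp
  | succ t ih =>
    rw [show (t + 1) * x + y = t * x + y + x by ring, F_add_self_right hx, ih, add_assoc]

theorem F_mul_add_succ {s : ℕ} (hs : 0 < s) (q e : ℕ) :
    F ((q + 1) * s + e) (q * s + e) = q + F s e := by
  induction q with
  | zero => simp [F_add_self_left]
  | succ q ih =>
    have hmod : ((q + 1) * s + e - ((q + 1 + 1) * s + e) % ((q + 1) * s + e)) %
        ((q + 1) * s + e) = q * s + e :=
      neg_mod_eq_of_add_eq_mul (d := 2) (by nlinarith) (by ring)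
    rw [F_of_pos (by nlinarith), hmod, ih]
    omega

theorem F_mul_sub_add {a b : ℕ} (ha : 2 ≤ a) (hb : 2 ≤ b) :
    F (a * b) (a * b - (a + b)) + 2 = F (b ^ 2) (a + b) + a * b / (a + b) := by
  have hs : 0 < a + b := by omega
  have hle : a + b ≤ a * b := by nlinarith
  have hmod : ((a + b) - b ^ 2 % (a + b)) % (a + b) = a * b % (a + b) := by
    refine neg_mod_eq_of_add_eq_mul (d := b - a * b / (a + b)) (Nat.mod_lt _ hs) ?_
    have hdiv := Nat.div_add_mod (a * b) (a + b)
    have hqb : a * b / (a + b) ≤ b := Nat.div_le_of_le_mul (by nlinarith)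
    zify [hqb] at hdiv ⊢
    linarith
  rw [F_of_pos hs, hmod]
  obtain ⟨q, hq⟩ : ∃ q, a * b / (a + b) = q + 1 :=
    ⟨a * b / (a + b) - 1, by have := Nat.div_pos hle hs; omega⟩
  have hdiv := Nat.div_add_mod (a * b) (a + b)
  rw [hq] at hdiv ⊢
  have h := F_mul_add_succ hs q (a * b % (a + b))
  rw [show (q + 1) * (a + b) + a * b % (a + b) = a * b by linarith,
    show q * (a + b) + a * b % (a + b) = a * b - (a + b) by
      refine (Nat.sub_eq_of_eq_add ?_).symm
      linarith] at h
  omega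

end EuclideanLength

section SmoothChain

/-- A path of positive integers `r 0, …, r m` followed by `r (m + 1) = 0`, in which every
`r i` with `1 ≤ i ≤ m` divides the sum of its neighbours with quotient `d i ≥ 2`. -/
def SmoothChain (m : ℕ) (r d : ℕ → ℕ) : Prop :=
  (∀ i, i ≤ m → 0 < r i) ∧ r (m + 1) = 0 ∧
    ∀ i, i < m → r i + r (i + 2) = d (i + 1) * r (i + 1) ∧ 2 ≤ d (i + 1)

namespace SmoothChain

variable {m : ℕ} {r d r' d' : ℕ → ℕ}

theorem shift (h : SmoothChain (m + 1) r d) :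
    SmoothChain m (fun i => r (i + 1)) (fun i => d (i + 1)) :=
  ⟨fun i hi => h.1 (i + 1) (by omega), h.2.1, fun i hi => h.2.2 (i + 1) (by omega)⟩

theorem one_lt_zero (h : SmoothChain m r d) : r 1 < r 0 := by
  induction m generalizing r d with
  | zero =>
    have h0 := h.1 0 le_rfl
    have h1 := h.2.1
    simp only [zero_add] at h1
    omega
  | succ m ih =>
    have h21 : r 2 < r 1 := ih h.shift
    have h0 := h.2.2 0 (by omega)
    simp only [zero_add] at h0
    nlinarith [Nat.mul_le_mul_right (r 1) h0.2]

theorem F_eq (h : SmoothChain m r d) : F (r 0) (r 1) = m + 1 := by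
  induction m generalizing r d with
  | zero => rw [show r 1 = 0 from h.2.1, F_zero_right]
  | succ m ih =>
    have hF : F (r 1) (r 2) = m + 1 := ih h.shift
    have hlt : r 2 < r 1 := h.shift.one_lt_zero
    rw [F_of_pos (h.1 1 (by omega)),
      neg_mod_eq_of_add_eq_mul hlt (h.2.2 0 (by omega)).1, hF, add_comm]

theorem unique (h : SmoothChain m r d) (h' : SmoothChain m r' d') (h0 : r 0 = r' 0)
    (h1 : r 1 = r' 1) :
    (∀ i, i ≤ m → r i = r' i) ∧ ∀ i, i < m → d (i + 1) = d' (i + 1) := by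
  induction m generalizing r d r' d' with
  | zero =>
    refine ⟨fun i hi => ?_, fun i hi => by omega⟩
    rw [Nat.le_zero.1 hi, h0]
  | succ m ih =>
    have hlt : r 2 < r 1 := h.shift.one_lt_zero
    have hlt' : r' 2 < r' 1 := h'.shift.one_lt_zero
    have e := (h.2.2 0 (by omega)).1
    have e' := (h'.2.2 0 (by omega)).1
    simp only [zero_add] at e e'
    have h2 : r 2 = r' 2 := by
      rw [← neg_mod_eq_of_add_eq_mul hlt e, ← neg_mod_eq_of_add_eq_mul hlt' e', h0, h1]
    obtain ⟨hr, hd⟩ := ih h.shift h'.shift h1 h2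
    constructor
    · rintro (_ | i) hi
      · exact h0
      · exact hr i (by omega)
    · rintro (_ | i) hi
      · refine Nat.eq_of_mul_eq_mul_right (h.1 1 (by omega)) ?_
        simp only [zero_add]
        rw [← e, h0, h2, e', h1]
      · exact hd i (by omega)

theorem exists_of_F_eq {x y : ℕ} (hxy : y < x) (h : F x y = m + 1) :
    ∃ r d, r 0 = x ∧ r 1 = y ∧ SmoothChain m r d := by
  induction m generalizing x y with
  | zero =>
    have hy : y = 0 := by
      by_contra hy
      rw [F_of_pos (Nat.pos_of_ne_zero hy)] at h
      have := F_pos y ((y - x % y) % y)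
      omega
    subst hy
    refine ⟨fun i => if i = 0 then x else 0, fun _ => 0, rfl, rfl, ?_, rfl, fun i hi => by omega⟩
    intro i hi
    rw [Nat.le_zero.1 hi]
    exact hxy
  | succ m ih =>
    have hy : 0 < y := by
      by_contra! hy
      rw [Nat.le_zero.1 hy, F_zero_right] at h
      omega
    rw [F_of_pos hy] at h
    obtain ⟨r, d, h0, h1, hc⟩ := ih (Nat.mod_lt (y - x % y) hy) (by omega)
    obtain ⟨c, hcx⟩ := exists_add_neg_mod_eq_mul x hy
    have hc2 : 2 ≤ c := by
      by_contra! hlt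
      have : c * y ≤ 1 * y := Nat.mul_le_mul_right y (by omega)
      omega
    refine ⟨fun i => Nat.casesOn i x r,
      fun i => Nat.casesOn i 0 (fun j => if j = 0 then c else d j),
      rfl, h0, ?_, hc.2.1, ?_⟩
    · rintro (_ | i) hi
      · exact Nat.zero_lt_of_lt hxy
      · exact hc.1 i (by omega)
    · rintro (_ | i) hi
      · refine ⟨?_, hc2⟩
        change x + r 1 = c * r 0
        rw [h0, h1, hcx]
      · exact hc.2.2 i (by omega)

theorem dvd (h : SmoothChain m r d) {k : ℕ} (h0 : k ∣ r 0) (h1 : k ∣ r 1) :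
    ∀ i, i ≤ m → k ∣ r i := by
  induction m generalizing r d with
  | zero => intro i hi; rwa [Nat.le_zero.1 hi]
  | succ m ih =>
    have e := (h.2.2 0 (by omega)).1
    simp only [zero_add] at e
    have h2 : k ∣ r 2 := (Nat.dvd_add_right h0).1 (e ▸ h1.mul_left _)
    rintro (_ | i) hi
    · exact h0
    · exact ih h.shift h1 h2 i (by omega)

end SmoothChain

end SmoothChain

section Bident

variable {n a b rx ry : ℕ} {d r : ℕ → ℕ}

/-- Extending `r` by zero turns the path of a smooth arithmetical structure into a chain. -/
theorem IsArith.smoothChain (h : IsArith n b a d rx ry r) (hs : IsSmooth n b a d) :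
    SmoothChain (n - 3) (fun i => if i ≤ n - 3 then r i else 0) d := by
  obtain ⟨-, -, -, -, -, -, hr, -, -, -, -, hmid, hend, -⟩ := h
  refine ⟨fun i hi => by simpa [hi] using hr i hi, by simp,
    fun i hi => ⟨?_, hs.2.2 _ (by omega) hi⟩⟩
  beta_reduce
  rw [if_pos hi.le, if_pos (show i + 1 ≤ n - 3 from hi)]
  split_ifs with hi2
  · exact (hmid (i + 1) (by omega) hi2).symm
  · have := hend (by omega)
    rw [show n - 3 = i + 1 by omega] at this
    exact this.symm

theorem IsArith.center (h : IsArith n b a d rx ry r) :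
    d 0 * r 0 = rx + ry + if 1 ≤ n - 3 then r 1 else 0 := by
  obtain ⟨-, -, -, -, -, -, -, -, -, hpos, hzero, -⟩ := h
  split_ifs with hn
  · exact hpos hn
  · exact hzero (by omega)

theorem IsArith.coprime (h : IsArith n b a d rx ry r) (hs : IsSmooth n b a d) :
    Nat.Coprime rx ry := by
  have hc := h.smoothChain hs
  have hcenter := h.center
  obtain ⟨-, -, -, -, -, -, -, hx, -, -, -, -, -, hgcd⟩ := h
  have h0 : Nat.gcd rx ry ∣ r 0 := hx ▸ (Nat.gcd_dvd_left rx ry).mul_left b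
  have h1 : Nat.gcd rx ry ∣ if 1 ≤ n - 3 then r 1 else 0 :=
    (Nat.dvd_add_right (Nat.dvd_add (Nat.gcd_dvd_left rx ry) (Nat.gcd_dvd_right rx ry))).1
      (hcenter ▸ h0.mul_left _)
  refine hgcd _ (Nat.gcd_dvd_left rx ry) (Nat.gcd_dvd_right rx ry) fun i hi => ?_
  simpa [hi] using hc.dvd (by simpa using h0) h1 i hi

theorem IsArith.eq_gcd_mul (h : IsArith n b a d rx ry r) (hs : IsSmooth n b a d) :
    a = Nat.gcd a b * rx ∧ b = Nat.gcd a b * ry := by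
  have hcop := h.coprime hs
  obtain ⟨-, -, -, -, hrx, -, -, hx, hy, -⟩ := h
  obtain ⟨g, rfl⟩ : rx ∣ a := hcop.dvd_of_dvd_mul_right (hy.trans hx.symm ▸ Dvd.intro_left b rfl)
  obtain rfl : b = ry * g := Nat.eq_of_mul_eq_mul_right hrx (by rw [hx, ← hy]; ring)
  rw [Nat.gcd_mul_right, hcop.gcd_eq_one, one_mul, mul_comm g, mul_comm g]
  exact ⟨rfl, rfl⟩

theorem add_le_mul_mul {g : ℕ} (hx : 2 ≤ g * rx) (hy : 2 ≤ g * ry) :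
    rx + ry ≤ g * rx * ry := by
  have hg : 0 < g := Nat.pos_of_ne_zero fun h => by simp [h] at hx
  refine Nat.le_of_mul_le_mul_left ?_ hg
  nlinarith

theorem IsArith.zero_one (h : IsArith n b a d rx ry r) (hs : IsSmooth n b a d) :
    d 0 = 1 ∧ r 0 = rx + ry + if 1 ≤ n - 3 then r 1 else 0 := by
  have hc := h.center
  have hlt := (h.smoothChain hs).one_lt_zero
  obtain ⟨hgx, hgy⟩ := h.eq_gcd_mul hs
  have hle := add_le_mul_mul (hgx ▸ hs.2.1) (hgy ▸ hs.1)
  have hr0 : Nat.gcd a b * rx * ry = r 0 := by rw [← hgx]; exact h.2.2.2.2.2.2.2.2.1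
  have hd0 : 0 < d 0 := h.2.2.2.1 0 (Nat.zero_le _)
  simp only [Nat.zero_le, if_true] at hlt
  have hd : d 0 = 1 := by
    by_contra hne
    have : 2 * r 0 ≤ d 0 * r 0 := Nat.mul_le_mul_right _ (by omega)
    omega
  rw [hd, one_mul] at hc
  exact ⟨hd, hc⟩

theorem IsArith.length_eq (h : IsArith n b a d rx ry r) (hs : IsSmooth n b a d) :
    n = F (a * b) (a * b - (a + b)) + 2 := by
  have hF := (h.smoothChain hs).F_eq
  obtain ⟨hgx, hgy⟩ := h.eq_gcd_mul hs
  have hr := (h.zero_one hs).2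
  have hg : 0 < Nat.gcd a b := Nat.gcd_pos_of_pos_left b (by have := hs.2.1; omega)
  have hn := h.1
  have hb : b * rx = r 0 := h.2.2.2.2.2.2.2.1
  simp only [Nat.zero_le, if_true] at hF
  have hab : a * b = Nat.gcd a b * r 0 := by
    rw [← hb]
    calc a * b = Nat.gcd a b * rx * b := by rw [← hgx]
      _ = _ := by ring
  have hsum : a + b = Nat.gcd a b * (rx + ry) := by rw [mul_add, ← hgx, ← hgy]
  rw [hab, hsum, ← Nat.mul_sub, F_mul_left hg,
    show r 0 - (rx + ry) = if 1 ≤ n - 3 then r 1 else 0 by omega, hF]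
  omega

theorem exists_isArith_isSmooth (ha : 2 ≤ a) (hb : 2 ≤ b)
    (hn : n = F (a * b) (a * b - (a + b)) + 2) :
    ∃ d rx ry r, IsArith n b a d rx ry r ∧ IsSmooth n b a d := by
  obtain ⟨g, rx, ry, hg, hcop, rfl, rfl⟩ :=
    Nat.exists_coprime' (Nat.gcd_pos_of_pos_left b (by omega : 0 < a))
  rw [mul_comm rx] at *
  rw [mul_comm ry] at *
  have hle := add_le_mul_mul ha hb
  have hrx : 0 < rx := Nat.pos_of_ne_zero fun h => by simp [h] at ha
  have hry : 0 < ry := Nat.pos_of_ne_zero fun h => by simp [h] at hb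
  rw [show g * rx * (g * ry) = g * (g * rx * ry) by ring, ← mul_add, ← Nat.mul_sub,
    F_mul_left hg] at hn
  have hF := F_pos (g * rx * ry) (g * rx * ry - (rx + ry))
  obtain ⟨r, d, h0, h1, hpos, hend, hmid⟩ := SmoothChain.exists_of_F_eq (m := n - 3)
    (show g * rx * ry - (rx + ry) < g * rx * ry by omega) (by omega)
  refine ⟨fun i => if i = 0 then 1 else d i, rx, ry, r,
    ⟨by omega, by omega, by omega, ?_, hrx, hry, hpos, ?_, ?_, ?_, ?_, ?_, ?_, ?_⟩, hb, ha, ?_⟩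
  · rintro (_ | i) hi
    · simp
    · have := (hmid i hi).2
      simp only [Nat.add_eq_zero_iff, one_ne_zero, and_false, if_false]
      omega
  · rw [h0]; ring
  · rw [h0]
  · intro _
    simp only [if_true]
    omega
  · intro hz
    rw [hz] at hend
    simp only [if_true, zero_add] at hend ⊢
    omega
  · rintro (_ | i) hi hi'
    · omega
    · simpa using (hmid i (by omega)).1.symm
  · intro hz
    obtain ⟨k, hk⟩ : ∃ k, n - 3 = k + 1 := ⟨n - 3 - 1, by omega⟩
    rw [hk] at hend ⊢
    have := (hmid k (by omega)).1
    rw [hend] at this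
    simpa using this.symm
  · intro c hcx hcy _
    exact Nat.eq_one_of_dvd_coprimes hcop hcx hcy
  · rintro (_ | i) hi hi'
    · omega
    · simpa using (hmid i hi').2

theorem IsArith.unique {rx' ry' : ℕ} {d' r' : ℕ → ℕ}
    (h : IsArith n b a d rx ry r) (hs : IsSmooth n b a d)
    (h' : IsArith n b a d' rx' ry' r') (hs' : IsSmooth n b a d') :
    rx = rx' ∧ ry = ry' ∧ ∀ i, i ≤ n - 3 → d i = d' i ∧ r i = r' i := by
  have hg : 0 < Nat.gcd a b := Nat.gcd_pos_of_pos_left b (by have := hs.2.1; omega)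
  obtain ⟨hgx, hgy⟩ := h.eq_gcd_mul hs
  obtain ⟨hgx', hgy'⟩ := h'.eq_gcd_mul hs'
  obtain rfl : rx = rx' := Nat.eq_of_mul_eq_mul_left hg (hgx.symm.trans hgx')
  obtain rfl : ry = ry' := Nat.eq_of_mul_eq_mul_left hg (hgy.symm.trans hgy')
  have h0 : r 0 = r' 0 := by
    rw [← h.2.2.2.2.2.2.2.1, ← h'.2.2.2.2.2.2.2.1]
  obtain ⟨hd, hr⟩ := h.zero_one hs
  obtain ⟨hd', hr'⟩ := h'.zero_one hs'
  obtain ⟨hcr, hcd⟩ := (h.smoothChain hs).unique (h'.smoothChain hs')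
    (by simpa using h0) (by omega)
  refine ⟨rfl, rfl, fun i hi => ⟨?_, by simpa [hi] using hcr i hi⟩⟩
  cases i with
  | zero => rw [hd, hd']
  | succ i => exact hcd i hi

end Bident


/-- **Theorem 3.3.**  Given integers `a, b ≥ 2`, write `a + b = t·b² + ε` with `t ≥ 0` and
`0 ≤ ε ≤ b² - 1`.  There is a (unique) smooth arithmetical structure on `D_n` with
`d_x = b` and `d_y = a` exactly when `n = F(b², ε) + t + ⌊ab/(a+b)⌋`, and no such structure
for any other value of `n`. -/
theorem smooth_length_formula (a b t ε : ℕ) (ha : 2 ≤ a) (hb : 2 ≤ b)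
    (hsum : a + b = t * b ^ 2 + ε) (hε : ε ≤ b ^ 2 - 1) :
    (∀ n : ℕ, (∃ d rx ry r, IsArith n b a d rx ry r ∧ IsSmooth n b a d) ↔
        n = F (b ^ 2) ε + t + a * b / (a + b)) ∧
    (∀ n d rx ry r d' rx' ry' r',
      IsArith n b a d rx ry r → IsSmooth n b a d →
      IsArith n b a d' rx' ry' r' → IsSmooth n b a d' →
      rx = rx' ∧ ry = ry' ∧ ∀ i, i ≤ n - 3 → d i = d' i ∧ r i = r' i) := by
  have hlen : F (a * b) (a * b - (a + b)) + 2 = F (b ^ 2) ε + t + a * b / (a + b) := by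
    rw [F_mul_sub_add ha hb, ← F_add_mul_self_right (by positivity) ε t, ← hsum]
  refine ⟨fun n => ⟨?_, fun hn => exists_isArith_isSmooth ha hb (hn.trans hlen.symm)⟩, ?_⟩
  · rintro ⟨d, rx, ry, r, h, hs⟩
    exact (h.length_eq hs).trans hlen
  · intro n d rx ry r d' rx' ry' r' h hs h' hs'
    exact h.unique hs h' hs'
end

section
/- Let k ≥ 0, let q₁, …, q_k be positive integers, and let b ≥ 2 be an integer. Let A_k denote the (1,1) entry of the 2×2 matrix product ∏_{i=1}^{k} [[q_i, 1], [1, 0]]. If Σ_{i odd, 1 ≤ i ≤ k} q_i > b and Σ_{i even, 1 ≤ i ≤ k} q_i > b, then A_k > b². -/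
/-- `Aval q j` is the `(1,1)` entry of the ordered matrix product
`[[q 1, 1],[1, 0]] * [[q 2, 1],[1, 0]] * ⋯ * [[q j, 1],[1, 0]]`. -/
def Aval (q : ℕ → ℕ) (j : ℕ) : ℕ :=
  (((List.range j).map fun i => !![q (i + 1), 1; 1, 0]).prod) 0 0

/-- `Sodd q j = ∑_{i odd, 1 ≤ i ≤ j} q i`. -/
def Sodd (q : ℕ → ℕ) (j : ℕ) : ℕ := ∑ i ∈ (Finset.Icc 1 j).filter (fun i => Odd i), q i

/-- `Seven q j = ∑_{i even, 1 ≤ i ≤ j} q i`. -/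
def Seven (q : ℕ → ℕ) (j : ℕ) : ℕ := ∑ i ∈ (Finset.Icc 1 j).filter (fun i => Even i), q i

theorem Aval_zero (q : ℕ → ℕ) : Aval q 0 = 1 := by
  simp [Aval]

theorem Aval_one (q : ℕ → ℕ) : Aval q 1 = q 1 := by
  simp [Aval]

/-- The three-term recurrence for continuants. -/
theorem Aval_add_two (q : ℕ → ℕ) (j : ℕ) :
    Aval q (j + 2) = q (j + 2) * Aval q (j + 1) + Aval q j := by
  simp only [Aval, List.range_succ, List.map_append, List.prod_append, List.map_cons,
    List.map_nil, List.prod_cons, List.prod_nil, mul_one, Matrix.mul_apply, Fin.sum_univ_two]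
  simp
  ring

theorem Sodd_two_mul_add_one (q : ℕ → ℕ) (n : ℕ) :
    Sodd q (2 * n + 1) = Sodd q (2 * n) + q (2 * n + 1) := by
  simp [Sodd, Finset.sum_filter, Finset.sum_Icc_succ_top]

theorem Sodd_two_mul_add_two (q : ℕ → ℕ) (n : ℕ) :
    Sodd q (2 * n + 2) = Sodd q (2 * n + 1) := by
  simp [Sodd, Finset.sum_filter, Finset.sum_Icc_succ_top, Nat.odd_add]

theorem Seven_two_mul_add_one (q : ℕ → ℕ) (n : ℕ) :
    Seven q (2 * n + 1) = Seven q (2 * n) := by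
  simp [Seven, Finset.sum_filter, Finset.sum_Icc_succ_top]

theorem Seven_two_mul_add_two (q : ℕ → ℕ) (n : ℕ) :
    Seven q (2 * n + 2) = Seven q (2 * n + 1) + q (2 * n + 2) := by
  simp [Seven, Finset.sum_filter, Finset.sum_Icc_succ_top, Nat.even_add]

theorem Seven_eq_zero_or_Sodd_pos (q : ℕ → ℕ) (n : ℕ) (hq : ∀ i, 1 ≤ i → i ≤ 2 * n → 0 < q i) :
    Seven q (2 * n) = 0 ∨ 0 < Sodd q (2 * n) := by
  cases n with
  | zero => simp [Seven]
  | succ n =>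
    right
    rw [show 2 * (n + 1) = 2 * n + 2 by ring, Sodd_two_mul_add_two, Sodd_two_mul_add_one]
    have := hq (2 * n + 1) (by lia) (by lia)
    lia

theorem even_step {O E o q A B : ℕ} (hq : 0 < q) (hE : E = 0 ∨ 0 < O)
    (hA : O * E + 1 ≤ A) (hB : (O + o) * E + (O + o) ≤ B + E) :
    (O + o) * (E + q) + 1 ≤ q * B + A := by
  have h := Nat.mul_le_mul_left q hB
  obtain rfl | hO := hE
  · nlinarith
  · obtain ⟨p, rfl⟩ := Nat.exists_eq_add_of_le' hq
    obtain ⟨r, rfl⟩ := Nat.exists_eq_add_of_le' hO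
    nlinarith [Nat.zero_le (p * r * E), Nat.zero_le (p * o * E), Nat.zero_le (r * E)]

theorem odd_step {O E e q A B : ℕ} (hq : 0 < q) (hO : 0 < O)
    (hA : O * E + O ≤ A + E) (hB : O * (E + e) + 1 ≤ B) :
    (O + q) * (E + e) + (O + q) ≤ q * B + A + (E + e) := by
  have h := Nat.mul_le_mul_left q hB
  obtain ⟨p, rfl⟩ := Nat.exists_eq_add_of_le' hq
  obtain ⟨r, rfl⟩ := Nat.exists_eq_add_of_le' hO
  nlinarith [Nat.zero_le (p * r * E), Nat.zero_le (p * r * e), Nat.zero_le (r * E)]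

theorem Sodd_mul_Seven_lt_Aval_even (q : ℕ → ℕ) (n : ℕ)
    (hq : ∀ i, 1 ≤ i → i ≤ 2 * n → 0 < q i)
    (hodd : ∀ m < n, Sodd q (2 * m + 1) * Seven q (2 * m + 1) + Sodd q (2 * m + 1) ≤
      Aval q (2 * m + 1) + Seven q (2 * m + 1)) :
    Sodd q (2 * n) * Seven q (2 * n) + 1 ≤ Aval q (2 * n) := by
  induction n with
  | zero => simp [Sodd, Aval_zero]
  | succ n ih =>
    have hn := hodd n (by lia)
    rw [show 2 * (n + 1) = 2 * n + 2 by ring, Aval_add_two, Sodd_two_mul_add_two,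
      Seven_two_mul_add_two]
    rw [Sodd_two_mul_add_one, Seven_two_mul_add_one] at *
    exact even_step (hq _ (by lia) (by lia))
      (Seven_eq_zero_or_Sodd_pos q n fun i h₁ h₂ => hq i h₁ (by lia))
      (ih (fun i h₁ h₂ => hq i h₁ (by lia)) fun m hm => hodd m (by lia)) hn

theorem Sodd_mul_Seven_add_Sodd_le_Aval_odd (q : ℕ → ℕ) (n : ℕ)
    (hq : ∀ i, 1 ≤ i → i ≤ 2 * n + 1 → 0 < q i) :
    Sodd q (2 * n + 1) * Seven q (2 * n + 1) + Sodd q (2 * n + 1) ≤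
      Aval q (2 * n + 1) + Seven q (2 * n + 1) := by
  induction n using Nat.strong_induction_on with
  | _ n ih =>
    cases n with
    | zero => simp [Sodd, Seven, Aval_one, Finset.sum_filter]
    | succ n =>
      have heven := Sodd_mul_Seven_lt_Aval_even q (n + 1) (fun i h₁ h₂ => hq i h₁ (by lia))
        fun m hm => ih m hm fun i h₁ h₂ => hq i h₁ (by lia)
      have hn := ih n (by lia) fun i h₁ h₂ => hq i h₁ (by lia)
      have hpos : 0 < Sodd q (2 * n + 1) := by
        have := hq (2 * n + 1) (by lia) (by lia)
        rw [Sodd_two_mul_add_one]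
        lia
      rw [Sodd_two_mul_add_one, Seven_two_mul_add_one]
      rw [show 2 * (n + 1) = 2 * n + 2 by ring, Sodd_two_mul_add_two,
        Seven_two_mul_add_two] at *
      rw [show 2 * n + 2 + 1 = 2 * n + 1 + 2 by ring] at *
      rw [Aval_add_two]
      exact odd_step (hq _ (by lia) (by lia)) hpos hn heven

/-- **Proposition 4.7.**  Let `k ≥ 0`, let `q₁, …, q_k` be positive integers, and let
`b ≥ 2`.  If `∑_{i odd, 1 ≤ i ≤ k} q_i > b` and `∑_{i even, 1 ≤ i ≤ k} q_i > b`, then the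
`(1,1)` entry of `∏_{i=1}^{k} [[q_i, 1],[1, 0]]` exceeds `b²`. -/
theorem Aval_gt_sq (k : ℕ) (q : ℕ → ℕ) (b : ℕ) (hb : 2 ≤ b)
    (hq : ∀ i, 1 ≤ i → i ≤ k → 0 < q i)
    (ho : b < Sodd q k) (he : b < Seven q k) :
    b ^ 2 < Aval q k := by
  obtain ⟨n, rfl | rfl⟩ := k.even_or_odd'
  · have h := Sodd_mul_Seven_lt_Aval_even q n hq fun m hm =>
      Sodd_mul_Seven_add_Sodd_le_Aval_odd q m fun i h₁ h₂ => hq i h₁ (by lia)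
    nlinarith
  · have h := Sodd_mul_Seven_add_Sodd_le_Aval_odd q n hq
    nlinarith
end
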